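/- arXiv:1907.10234 — 4 statements merged into one kernel-verified Lean document; each statement's English description precedes it below -/
import Mathlib

section
/- Let X be a set, let R : X × X → X × X satisfy the set-theoretical Yang–Baxter equation, and let D : X → X be an involution that is mirror-compatible with R. Define K : X → X by K(b) = snd (R (D b, b)). Then the set-theoretical reflection equation holds: R ∘ (K × id) ∘ R ∘ (K × id) = (K × id) ∘ R ∘ (K × id) ∘ R as maps X × X → X × X, where (K × id)(a,b) = (K a, b). -/
/-- A map `R : X × X → X × X` acting on the first two factors of `X × X × X`. -/
def yb12 {X : Type*} (R : X × X → X × X) : X × X × X → X × X × X :=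
  fun p => ((R (p.1, p.2.1)).1, (R (p.1, p.2.1)).2, p.2.2)

/-- A map `R : X × X → X × X` acting on the last two factors of `X × X × X`. -/
def yb23 {X : Type*} (R : X × X → X × X) : X × X × X → X × X × X :=
  fun p => (p.1, R p.2)

/-- In a monoid, the folding of the `A₃` braid relations along `s₁ ↔ s₃` gives the `B₂` braid
relation. -/
theorem braid_fold {M : Type*} [Monoid M] {s t u : M} (hst : s * t * s = t * s * t)
    (htu : t * u * t = u * t * u) (hsu : s * u = u * s) :
    (s * u) * t * (s * u) * t = t * (s * u) * t * (s * u) :=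
  calc (s * u) * t * (s * u) * t = s * (u * t * u) * s * t := by
        simp only [hsu, mul_assoc]
        rw [← mul_assoc u s, ← hsu, mul_assoc]
    _ = s * t * u * (t * s * t) := by rw [← htu]; simp only [mul_assoc]
    _ = s * t * (u * s) * t * s := by rw [← hst]; simp only [mul_assoc]
    _ = (s * t * s) * u * t * s := by rw [← hsu]; simp only [mul_assoc]
    _ = t * s * (t * u * t) * s := by rw [hst]; simp only [mul_assoc]
    _ = t * (s * u) * t * (u * s) := by rw [htu]; simp only [mul_assoc]
    _ = t * (s * u) * t * (s * u) := by rw [hsu]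

/-- If `R` satisfies the set-theoretical Yang–Baxter equation and `D` is an involution
that is mirror-compatible with `R`, then `K b := snd (R (D b, b))` together with `R`
satisfies the set-theoretical reflection equation. -/
theorem stmt0 {X : Type*} (R : X × X → X × X) (D : X → X)
    (hYB : yb12 R ∘ yb23 R ∘ yb12 R = yb23 R ∘ yb12 R ∘ yb23 R)
    (hD : D ∘ D = id)
    (hmirror : ∀ a b c d : X, R (a, b) = (c, d) → R (D b, D a) = (D d, D c))
    (K : X → X) (hK : ∀ b, K b = (R (D b, b)).2) :
    R ∘ Prod.map K id ∘ R ∘ Prod.map K id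
      = Prod.map K id ∘ R ∘ Prod.map K id ∘ R := by
  have hDD : ∀ x, D (D x) = x := congrFun hD
  -- The three adjacent copies of `R` on `X⁴`.
  let s : Function.End (X × X × X × X) :=
    fun p => ((R (p.1, p.2.1)).1, (R (p.1, p.2.1)).2, p.2.2)
  let t : Function.End (X × X × X × X) := fun p => (p.1, yb12 R p.2)
  let u : Function.End (X × X × X × X) := fun p => (p.1, yb23 R p.2)
  have hst : s * t * s = t * s * t := by
    funext ⟨a, b, c, d⟩
    exact congrArg (fun q => (q.1, q.2.1, q.2.2, d)) (congrFun hYB (a, b, c))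
  have htu : t * u * t = u * t * u := by
    funext ⟨a, p⟩
    exact congrArg (Prod.mk a) (congrFun hYB p)
  have hsu : s * u = u * s := rfl
  -- A pair together with its mirror image.
  let E : X × X → X × X × X × X := fun p => (D p.2, D p.1, p.1, p.2)
  have hE : Function.Injective E := fun p q h => congrArg (fun x => x.2.2) h
  have hER : ∀ p, E (R p) = (s * u) (E p) := by
    rintro ⟨a, b⟩
    have h := hmirror a b _ _ rfl
    change _ = ((R (D b, D a)).1, (R (D b, D a)).2, R (a, b))
    rw [h]
  have hEK : ∀ p, E (Prod.map K id p) = t (E p) := by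
    rintro ⟨a, b⟩
    have h := hmirror (D a) a _ _ rfl
    rw [hDD] at h
    have h1 : D (R (D a, a)).2 = (R (D a, a)).1 := (congrArg Prod.fst h).symm
    simp [E, t, yb12, hK, h1]
  funext p
  apply hE
  simp only [Function.comp_apply, hER, hEK]
  have h : (s * u) * t * (s * u) * t = t * (s * u) * t * (s * u) := braid_fold hst htu hsu
  exact congrFun h (E p)
end

section
/- Let A, B, A', B' be sets, with bijections D_A : A → A', D_B : B → B' (write a^∨ for the image of a under the appropriate bijection or its inverse, so that (a^∨)^∨ = a, and X^∨ denotes the dual set of X ∈ {A,B,A',B'}). Suppose that for every ordered pair (X,Y) of sets from {A,B,A',B'} there is a map R_{X,Y} : X × Y → Y × X such that (i) for every triple (X,Y,Z) from {A,B,A',B'} the Yang–Baxter equation (R_{Y,Z} × 1)(1 × R_{X,Z})(R_{X,Y} × 1) = (1 × R_{X,Y})(R_{X,Z} × 1)(1 × R_{Y,Z}) holds as maps X × Y × Z → Z × Y × X, and (ii) whenever R_{X,Y}(a,b) = (c,d) one has R_{Y^∨,X^∨}(b^∨, a^∨) = (d^∨, c^∨). Define K_A : A → A' by K_A(a) = snd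 (R_{A',A}(a^∨, a)), and K_B : B → B' analogously. Then the set-theoretical reflection equation holds: R_{B',A'} ∘ (K_B × id) ∘ R_{A',B} ∘ (K_A × id) = (K_A × id) ∘ R_{B',A} ∘ (K_B × id) ∘ R_{A,B} as maps A × B → B' × A'. -/
/-- Index set for the four sets `A, B, A', B'` of the reflection-equation setup. -/
inductive RefIdx : Type
  | A | B | A' | B'

/-- Duality on indices: `A ↔ A'`, `B ↔ B'`. -/
def RefIdx.dual : RefIdx → RefIdx
  | .A => .A'
  | .B => .B'
  | .A' => .A
  | .B' => .B

/-- The four carrier sets. -/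
def RefIdx.carrier (A B A' B' : Type) : RefIdx → Type
  | .A => A
  | .B => B
  | .A' => A'
  | .B' => B'

/-- The duality map `x ↦ x^∨`, given on each set by the appropriate bijection
(`D_A`, `D_B`) or its inverse, so that `(x^∨)^∨ = x`. -/
def RefIdx.dualMap {A B A' B' : Type} (DA : A ≃ A') (DB : B ≃ B') :
    ∀ i : RefIdx, RefIdx.carrier A B A' B' i → RefIdx.carrier A B A' B' i.dual
  | .A => fun a => DA a
  | .B => fun b => DB b
  | .A' => fun a => DA.symm a
  | .B' => fun b => DB.symm b

namespace Braiding

variable {I : Type*} {C : I → Type*} (R : ∀ i j : I, C i × C j → C j × C i)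

/-- Apply the braiding to the first two factors of a fourfold product. -/
def fst (i j k l : I) (x : C i × C j × C k × C l) : C j × C i × C k × C l :=
  ((R i j (x.1, x.2.1)).1, (R i j (x.1, x.2.1)).2, x.2.2)

/-- Apply the braiding to the two middle factors of a fourfold product. -/
def mid (i j k l : I) (x : C i × C j × C k × C l) : C i × C k × C j × C l :=
  (x.1, (R j k (x.2.1, x.2.2.1)).1, (R j k (x.2.1, x.2.2.1)).2, x.2.2.2)

/-- Apply the braiding to the last two factors of a fourfold product. -/
def last (i j k l : I) (x : C i × C j × C k × C l) : C i × C j × C l × C k :=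
  (x.1, x.2.1, R k l x.2.2)

/-- The Yang–Baxter equation for every triple of indices. -/
def YangBaxter : Prop :=
  ∀ (i j k : I) (a : C i) (b : C j) (c : C k),
    (let r1 := R i j (a, b)
     let r2 := R i k (r1.2, c)
     let r3 := R j k (r1.1, r2.1)
     (r3.1, r3.2, r2.2))
    =
    (let s1 := R j k (b, c)
     let s2 := R i k (a, s1.1)
     let s3 := R i j (s2.2, s1.2)
     (s2.1, s3.1, s3.2))

theorem last_fst (i j k l : I) (x : C i × C j × C k × C l) :
    last R _ _ _ _ (fst R i j k l x) = fst R _ _ _ _ (last R i j k l x) := rfl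

variable {R}

theorem YangBaxter.fst_mid_fst (h : YangBaxter R) (i j k l : I) (x : C i × C j × C k × C l) :
    fst R _ _ _ _ (mid R _ _ _ _ (fst R i j k l x)) =
      mid R _ _ _ _ (fst R _ _ _ _ (mid R i j k l x)) := by
  obtain ⟨a, b, c, d⟩ := x
  exact congrArg (fun t => (t.1, t.2.1, t.2.2, d)) (h i j k a b c)

theorem YangBaxter.mid_last_mid (h : YangBaxter R) (i j k l : I) (x : C i × C j × C k × C l) :
    mid R _ _ _ _ (last R _ _ _ _ (mid R i j k l x)) =
      last R _ _ _ _ (mid R _ _ _ _ (last R i j k l x)) := by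
  obtain ⟨a, b, c, d⟩ := x
  exact congrArg (Prod.mk a) (h j k l b c d)

/-- Two reduced words for the longest permutation of four strands act equally. -/
theorem YangBaxter.longest_word (h : YangBaxter R) (i j k l : I) (x : C i × C j × C k × C l) :
    last R _ _ _ _ (fst R _ _ _ _ (mid R _ _ _ _
        (last R _ _ _ _ (fst R _ _ _ _ (mid R i j k l x))))) =
      mid R _ _ _ _ (last R _ _ _ _ (fst R _ _ _ _ (mid R _ _ _ _
        (last R _ _ _ _ (fst R i j k l x))))) := by
  rw [last_fst R i k j l, h.fst_mid_fst, h.mid_last_mid, ← last_fst,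
    ← h.mid_last_mid, ← h.fst_mid_fst, ← last_fst R i j k l]

end Braiding

/-- Abstract form of Theorem 2.5 of the paper: given maps `R_{X,Y} : X × Y → Y × X`
for all `X, Y ∈ {A, B, A', B'}` satisfying (i) the Yang–Baxter equation for every
triple and (ii) duality compatibility, the maps `K_A (a) = snd (R_{A',A}(a^∨, a))`
and `K_B (b) = snd (R_{B',B}(b^∨, b))` satisfy the set-theoretical reflection
equation together with `R`. -/
theorem stmt1 {A B A' B' : Type} (DA : A ≃ A') (DB : B ≃ B')
    (R : ∀ i j : RefIdx,
      RefIdx.carrier A B A' B' i × RefIdx.carrier A B A' B' j →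
        RefIdx.carrier A B A' B' j × RefIdx.carrier A B A' B' i)
    -- (i) the Yang–Baxter equation for every triple, as maps `X × Y × Z → Z × Y × X`
    (hYB : ∀ (i j k : RefIdx) (a : RefIdx.carrier A B A' B' i)
      (b : RefIdx.carrier A B A' B' j) (c : RefIdx.carrier A B A' B' k),
      (let r1 := R i j (a, b)
       let r2 := R i k (r1.2, c)
       let r3 := R j k (r1.1, r2.1)
       (r3.1, r3.2, r2.2))
      =
      (let s1 := R j k (b, c)
       let s2 := R i k (a, s1.1)
       let s3 := R i j (s2.2, s1.2)
       (s2.1, s3.1, s3.2)))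
    -- (ii) duality compatibility: if `R_{X,Y}(a,b) = (c,d)` then
    -- `R_{Y^∨,X^∨}(b^∨, a^∨) = (d^∨, c^∨)`
    (hdual : ∀ (i j : RefIdx) (a : RefIdx.carrier A B A' B' i)
      (b : RefIdx.carrier A B A' B' j),
      R j.dual i.dual (RefIdx.dualMap DA DB j b, RefIdx.dualMap DA DB i a)
        = (RefIdx.dualMap DA DB i (R i j (a, b)).2,
           RefIdx.dualMap DA DB j (R i j (a, b)).1))
    (KA : A → A') (hKA : ∀ a : A, KA a = (R RefIdx.A' RefIdx.A (DA a, a)).2)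
    (KB : B → B') (hKB : ∀ b : B, KB b = (R RefIdx.B' RefIdx.B (DB b, b)).2) :
    -- the set-theoretical reflection equation
    -- `R_{B',A'} ∘ (K_B × id) ∘ R_{A',B} ∘ (K_A × id)
    --    = (K_A × id) ∘ R_{B',A} ∘ (K_B × id) ∘ R_{A,B}`
    ∀ (a : A) (b : B),
      (let l1 := R RefIdx.A' RefIdx.B (KA a, b)
       R RefIdx.B' RefIdx.A' (KB l1.1, l1.2))
      =
      (let r1 := R RefIdx.A RefIdx.B (a, b)
       let r2 := R RefIdx.B' RefIdx.A (KB r1.1, r1.2)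
       (KA r2.1, r2.2)) := by
  intro a b
  have mirrorA (x : A) : R .A' .A (DA x, x) = (DA.symm (KA x), KA x) := by
    have h : R .A' .A (DA x, DA.symm (DA x)) =
        (DA.symm (R .A' .A (DA x, x)).2, DA (R .A' .A (DA x, x)).1) := hdual .A' .A (DA x) x
    rw [DA.symm_apply_apply] at h
    rw [hKA]
    have h1 := congrArg Prod.fst h
    exact Prod.ext h1 rfl
  have mirrorB (x : B) : R .B' .B (DB x, x) = (DB.symm (KB x), KB x) := by
    have h : R .B' .B (DB x, DB.symm (DB x)) =
        (DB.symm (R .B' .B (DB x, x)).2, DB (R .B' .B (DB x, x)).1) := hdual .B' .B (DB x) x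
    rw [DB.symm_apply_apply] at h
    rw [hKB]
    have h1 := congrArg Prod.fst h
    exact Prod.ext h1 rfl
  have key := congrArg (fun t => t.2.2) <|
    Braiding.YangBaxter.longest_word hYB .B' .A' .A .B (DB b, DA a, a, b)
  have dualAB : R .B' .A' (DB b, DA a) = (DA (R .A .B (a, b)).2, DB (R .A .B (a, b)).1) :=
    hdual .A .B a b
  have dualRightB (x : A') (y : B) : R .B' .A (DB y, DA.symm x) =
      (DA.symm (R .A' .B (x, y)).2, DB (R .A' .B (x, y)).1) := hdual .A' .B x y
  have dualRightA (x : B') (y : A) : R .A' .B (DA y, DB.symm x) =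
      (DB.symm (R .B' .A (x, y)).2, DA (R .B' .A (x, y)).1) := hdual .B' .A x y
  simp only [Braiding.fst, Braiding.mid, Braiding.last] at key
  rw [mirrorA a, dualAB] at key
  dsimp only at key
  rw [dualRightB] at key
  dsimp only at key
  erw [mirrorB, mirrorB] at key
  dsimp only at key
  erw [dualRightA] at key
  dsimp only at key
  erw [mirrorA] at key
  exact key
end

section
/- Fix integers 1 ≤ k ≤ n−1 and l ≥ 1. Let T be a semistandard tableau of rectangular shape with k rows and l columns whose entries lie in {0,1,…,n−1} (rows weakly increasing, columns strictly increasing). Define T^∨ of rectangular shape with n−k rows and l columns by: for 0 ≤ j < l, the j-th column of T^∨ lists, in strictly increasing order, the elements of {0,1,…,n−1} not appearing in column l−1−j of T. Then T^∨ is a semistandard tableau: its rows are weakly increasing and its columns are strictly increasing. -/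
open Finset in
/-- If two injections have complementary ranges, then the number of their values satisfying a
predicate adds up to the number of all elements satisfying it. -/
theorem card_filter_add_card_filter_of_range_eq_compl {ι κ α : Type*} [Fintype ι] [Fintype κ]
    [Fintype α] {f : ι → α} {f' : κ → α} (hf : f.Injective) (hf' : f'.Injective)
    (h : Set.range f' = (Set.range f)ᶜ) (p : α → Prop) [DecidablePred p] :
    #{i | p (f i)} + #{i | p (f' i)} = #{a | p a} := by
  classical
  have hmem (a : α) : (∃ i, f' i = a) ↔ ¬ ∃ i, f i = a := Set.ext_iff.1 h a
  rw [← card_image_of_injective _ hf, ← card_image_of_injective _ hf', ← card_union_of_disjoint]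
  · congr 1
    ext a
    simp only [mem_union, mem_image, mem_filter, mem_univ, true_and]
    constructor
    · rintro (⟨i, hi, rfl⟩ | ⟨i, hi, rfl⟩) <;> exact hi
    · intro ha
      by_cases hfa : ∃ i, f i = a
      · obtain ⟨i, rfl⟩ := hfa
        exact .inl ⟨i, ha, rfl⟩
      · obtain ⟨i, rfl⟩ := (hmem a).2 hfa
        exact .inr ⟨i, ha, rfl⟩
  · rw [disjoint_left]
    simp only [mem_image, not_exists]
    rintro _ ⟨i, -, rfl⟩ j ⟨-, hj⟩
    exact (hmem (f i)).1 ⟨j, hj⟩ ⟨i, rfl⟩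

open Finset in
/-- Passing to increasing enumerations of complements reverses the pointwise order. -/
theorem StrictMono.le_of_range_eq_compl {ι κ α : Type*} [Fintype ι] [Fintype κ] [Fintype α]
    [LinearOrder κ] [LinearOrder α] {f g : ι → α} {f' g' : κ → α}
    (hf : f.Injective) (hg : g.Injective) (hf' : StrictMono f') (hg' : StrictMono g')
    (hff' : Set.range f' = (Set.range f)ᶜ) (hgg' : Set.range g' = (Set.range g)ᶜ)
    (hfg : f ≤ g) : g' ≤ f' := by
  intro i
  by_contra! hi
  have cf := card_filter_add_card_filter_of_range_eq_compl hf hf'.injective hff' (· ≤ f' i)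
  have cg := card_filter_add_card_filter_of_range_eq_compl hg hg'.injective hgg' (· ≤ f' i)
  have hle : #{p | g p ≤ f' i} ≤ #{p | f p ≤ f' i} :=
    card_le_card (monotone_filter_right _ fun p _ hp => (hfg p).trans hp)
  have hlt : #{q | g' q ≤ f' i} < #{q | f' q ≤ f' i} := by
    refine card_lt_card (ssubset_iff_of_subset ?_ |>.2 ⟨i, by simp, by simpa using hi⟩)
    exact monotone_filter_right _ fun q _ hq =>
      hf'.monotone (hg'.lt_iff_lt.1 (lt_of_le_of_lt hq hi)).le
  omega


/-- The dual of a rectangular semistandard tableau is semistandard.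
`T : Fin k → Fin l → Fin n` is a `k × l` semistandard tableau (rows weakly
increasing, columns strictly increasing) with entries in `{0, …, n-1}`, and
`T' : Fin (n-k) → Fin l → Fin n` is its dual: for each `j`, the `j`-th column of `T'`
lists in strictly increasing order the complement in `Fin n` of the entries of
column `l - 1 - j` of `T`.  Then the rows of `T'` are weakly increasing and its
columns are strictly increasing. -/
theorem stmt5 (n k l : ℕ) (hk : 1 ≤ k) (hkn : k ≤ n - 1) (hl : 1 ≤ l)
    (T : Fin k → Fin l → Fin n)
    (hrow : ∀ i : Fin k, Monotone (T i))
    (hcol : ∀ j : Fin l, StrictMono (fun i => T i j))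
    (T' : Fin (n - k) → Fin l → Fin n)
    (hcol' : ∀ j : Fin l, StrictMono (fun i => T' i j))
    (hcompl : ∀ j : Fin l,
      Set.range (fun i => T' i j) = (Set.range (fun i => T i j.rev))ᶜ) :
    (∀ i : Fin (n - k), Monotone (T' i))
      ∧ (∀ j : Fin l, StrictMono (fun i => T' i j)) := by
  refine ⟨fun i j₁ j₂ hj => ?_, hcol'⟩
  exact StrictMono.le_of_range_eq_compl (hcol j₂.rev).injective (hcol j₁.rev).injective
    (hcol' j₂) (hcol' j₁) (hcompl j₂) (hcompl j₁)
    (fun p => hrow p (Fin.rev_le_rev.2 hj)) i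
end

section
/- Let 1 ≤ k ≤ n−1 and let s, t : Fin k → Fin n be strictly increasing maps such that s i ≤ t i for all i. Let s', t' : Fin (n−k) → Fin n be the strictly increasing enumerations of the complements in Fin n of the ranges of s and t respectively. Then t' i ≤ s' i for all i. -/
/-- If the ranges of two injective maps are complementary, then the preimages of an initial segment
under them have total size that of the segment. -/
theorem card_filter_le_add_card_filter_le {α β γ : Type*} [Fintype α] [Fintype β]
    [LinearOrder γ] [LocallyFiniteOrderBot γ] {f : α → γ} {g : β → γ}
    (hf : Function.Injective f) (hg : Function.Injective g)
    (h : Set.range g = (Set.range f)ᶜ) (x : γ) :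
    (Finset.univ.filter fun a => f a ≤ x).card + (Finset.univ.filter fun b => g b ≤ x).card =
      (Finset.Iic x).card := by
  have hdisj : Disjoint ((Finset.univ.filter fun a => f a ≤ x).image f)
      ((Finset.univ.filter fun b => g b ≤ x).image g) := by
    rw [Finset.disjoint_left]
    intro y hy hy'
    obtain ⟨a, -, rfl⟩ := Finset.mem_image.1 hy
    obtain ⟨b, -, hb⟩ := Finset.mem_image.1 hy'
    have hmem : g b ∈ (Set.range f)ᶜ := h ▸ Set.mem_range_self b
    exact hmem ⟨a, hb.symm⟩
  rw [← Finset.card_image_of_injective _ hf, ← Finset.card_image_of_injective _ hg,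
    ← Finset.card_union_of_disjoint hdisj]
  congr 1
  ext y
  simp only [Finset.mem_union, Finset.mem_image, Finset.mem_filter, Finset.mem_univ, true_and,
    Finset.mem_Iic]
  constructor
  · rintro (⟨a, ha, rfl⟩ | ⟨b, hb, rfl⟩) <;> assumption
  · intro hy
    by_cases hyf : y ∈ Set.range f
    · obtain ⟨a, rfl⟩ := hyf
      exact Or.inl ⟨a, hy, rfl⟩
    · have hyg : y ∈ Set.range g := h ▸ hyf
      obtain ⟨b, rfl⟩ := hyg
      exact Or.inr ⟨b, hy, rfl⟩


/-- Entrywise complement-reversal lemma: if `s, t : Fin k → Fin n` are strictly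
increasing with `s i ≤ t i` for all `i`, and `s', t' : Fin (n-k) → Fin n` are the
strictly increasing enumerations of the complements of the ranges of `s` and `t`,
then `t' i ≤ s' i` for all `i`. -/
theorem stmt7 (n k : ℕ) (hk : 1 ≤ k) (hkn : k ≤ n - 1)
    (s t : Fin k → Fin n) (hs : StrictMono s) (ht : StrictMono t)
    (hst : ∀ i : Fin k, s i ≤ t i)
    (s' t' : Fin (n - k) → Fin n)
    (hs' : StrictMono s') (ht' : StrictMono t')
    (hs'range : Set.range s' = (Set.range s)ᶜ)
    (ht'range : Set.range t' = (Set.range t)ᶜ) :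
    ∀ i : Fin (n - k), t' i ≤ s' i := by
  intro i
  by_contra! hlt
  have hcs := card_filter_le_add_card_filter_le hs.injective hs'.injective hs'range (s' i)
  have hct := card_filter_le_add_card_filter_le ht.injective ht'.injective ht'range (s' i)
  have hle : (Finset.univ.filter fun j => t j ≤ s' i).card ≤
      (Finset.univ.filter fun j => s j ≤ s' i).card :=
    Finset.card_le_card <| Finset.monotone_filter_right _ fun j _ hj => (hst j).trans hj
  have hss : (Finset.univ.filter fun j => t' j ≤ s' i) ⊂
      Finset.univ.filter fun j => s' j ≤ s' i := by
    rw [Finset.ssubset_iff_of_subset]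
    · exact ⟨i, by simp, by simpa using hlt⟩
    · intro j hj
      simp only [Finset.mem_filter, Finset.mem_univ, true_and] at hj ⊢
      exact hs'.monotone (ht'.lt_iff_lt.1 (hj.trans_lt hlt)).le
  have := Finset.card_lt_card hss
  omega
end
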